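/- Let R ↦ R₁ and R ↦ R₂ be two stabilizations of rectangular diagrams of links which have the same oriented type and are performed on the connected component of R with the same number. Then R₁ and R₂ are related by a chain of exchange moves. -/

import Mathlib

open scoped Real

noncomputable section

namespace RectDiag

instance : DecidableEq Real.Angle := Classical.decEq _

/-- The torus `T² = S¹ × S¹` with angular coordinates `(θ, φ)`. -/
abbrev Torus := Real.Angle × Real.Angle

/-- The length of the arc running from `x` to `y` in the positive direction. -/
def arcLen (x y : Real.Angle) : ℝ :=
  if (y - x).toReal < 0 then (y - x).toReal + 2 * Real.pi else (y - x).toReal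

/-- The closed arc `[x;y]` running from `x` to `y` in the positive direction. -/
def Arc (x y : Real.Angle) : Set Real.Angle :=
  {z | ∃ t : ℝ, 0 ≤ t ∧ t ≤ arcLen x y ∧ z = x + (t : Real.Angle)}

/-- The open arc `(x;y)`, the interior of `[x;y]`. -/
def ArcInt (x y : Real.Angle) : Set Real.Angle :=
  {z | ∃ t : ℝ, 0 < t ∧ t < arcLen x y ∧ z = x + (t : Real.Angle)}

/-- Every meridian `{θ}×S¹` contains no or exactly two points of `V`, of opposite signs. -/
def MeridianOK (V : Finset Torus) (sgn : Torus → Bool) : Prop :=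
  ∀ θ : Real.Angle, (∀ v ∈ V, v.1 ≠ θ) ∨
    ∃ u w, u ∈ V ∧ w ∈ V ∧ u ≠ w ∧ u.1 = θ ∧ w.1 = θ ∧ sgn u ≠ sgn w ∧
      ∀ x ∈ V, x.1 = θ → x = u ∨ x = w

/-- Every longitude `S¹×{φ}` contains no or exactly two points of `V`, of opposite signs. -/
def LongitudeOK (V : Finset Torus) (sgn : Torus → Bool) : Prop :=
  ∀ φ : Real.Angle, (∀ v ∈ V, v.2 ≠ φ) ∨
    ∃ u w, u ∈ V ∧ w ∈ V ∧ u ≠ w ∧ u.2 = φ ∧ w.2 = φ ∧ sgn u ≠ sgn w ∧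
      ∀ x ∈ V, x.2 = φ → x = u ∨ x = w

/-- `V` with sign assignment `sgn` satisfies the conditions of a rectangular diagram. -/
def IsDiagSet (V : Finset Torus) (sgn : Torus → Bool) : Prop :=
  MeridianOK V sgn ∧ LongitudeOK V sgn

/-- `S` is a connected component of `V`: a minimal nonempty subset of `V` that is itself a
rectangular diagram of a link (with the inherited signs). -/
def IsComponent (V : Finset Torus) (sgn : Torus → Bool) (S : Finset Torus) : Prop :=
  S ⊆ V ∧ S.Nonempty ∧ IsDiagSet S sgn ∧
    ∀ S' ⊆ S, S'.Nonempty → IsDiagSet S' sgn → S' = S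

/-- An oriented rectangular diagram of a link with numbered connected components:
a finite subset of the torus with a sign assignment satisfying the meridian/longitude
conditions, together with a numbering of the vertices which is constant exactly on
connected components. -/
structure RectDiagram where
  verts : Finset Torus
  sgn : Torus → Bool
  comp : Torus → ℕ
  diag : IsDiagSet verts sgn
  comp_eq_iff : ∀ u ∈ verts, ∀ v ∈ verts,
    (comp u = comp v ↔ ∃ S, IsComponent verts sgn S ∧ u ∈ S ∧ v ∈ S)

/-- `{u,v}` is a (vertical or horizontal) edge of the diagram `R`. -/
def IsEdge (R : RectDiagram) (u v : Torus) : Prop :=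
  u ∈ R.verts ∧ v ∈ R.verts ∧ u ≠ v ∧ (u.1 = v.1 ∨ u.2 = v.2)

/-- The four corner points `{θ₁,θ₂}×{φ₁,φ₂}`. -/
def corners (t1 t2 p1 p2 : Real.Angle) : Finset Torus :=
  {(t1, p1), (t1, p2), (t2, p1), (t2, p2)}

/-- The rectangle `[θ₁;θ₂]×[φ₁;φ₂] ⊆ T²`. -/
def RectSet (t1 t2 p1 p2 : Real.Angle) : Set Torus :=
  {p | p.1 ∈ Arc t1 t2 ∧ p.2 ∈ Arc p1 p2}

/-- `R₁ ↦ R₂` is an elementary move associated with the rectangle `[θ₁;θ₂]×[φ₁;φ₂]`. -/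
def IsElemMoveWith (R₁ R₂ : RectDiagram) (t1 t2 p1 p2 : Real.Angle) : Prop :=
  t1 ≠ t2 ∧ p1 ≠ p2 ∧
  symmDiff R₁.verts R₂.verts = corners t1 t2 p1 p2 ∧
  (∃ u v : Torus, u ∈ symmDiff R₁.verts R₂.verts ∧ v ∈ symmDiff R₁.verts R₂.verts ∧
      (IsEdge R₁ u v ∨ IsEdge R₂ u v)) ∧
  ¬ R₁.verts ⊆ R₂.verts ∧ ¬ R₂.verts ⊆ R₁.verts ∧
  RectSet t1 t2 p1 p2 ∩ (↑R₁.verts ∪ ↑R₂.verts) = ↑(corners t1 t2 p1 p2) ∧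
  ∀ v ∈ R₁.verts ∩ R₂.verts, R₁.sgn v = R₂.sgn v ∧ R₁.comp v = R₂.comp v

/-- `R₁ ↦ R₂` is an elementary move. -/
def IsElemMove (R₁ R₂ : RectDiagram) : Prop :=
  ∃ t1 t2 p1 p2 : Real.Angle, IsElemMoveWith R₁ R₂ t1 t2 p1 p2

/-- An exchange move. -/
def IsExchange (R₁ R₂ : RectDiagram) : Prop :=
  IsElemMove R₁ R₂ ∧ R₂.verts.card = R₁.verts.card

/-- A stabilization. -/
def IsStab (R₁ R₂ : RectDiagram) : Prop :=
  IsElemMove R₁ R₂ ∧ R₂.verts.card = R₁.verts.card + 2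

/-- A destabilization. -/
def IsDestab (R₁ R₂ : RectDiagram) : Prop :=
  IsElemMove R₁ R₂ ∧ R₁.verts.card = R₂.verts.card + 2

/-- A stabilization associated with a given rectangle. -/
def IsStabWith (R₁ R₂ : RectDiagram) (t1 t2 p1 p2 : Real.Angle) : Prop :=
  IsElemMoveWith R₁ R₂ t1 t2 p1 p2 ∧ R₂.verts.card = R₁.verts.card + 2

/-- The type I corner condition: `R₁ ∩ V ⊆ {(θ₁,φ₁),(θ₂,φ₂)}`. -/
def TypeICornerCond (R₁ : RectDiagram) (t1 t2 p1 p2 : Real.Angle) : Prop :=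
  ∀ v ∈ R₁.verts, v ∈ corners t1 t2 p1 p2 → v = (t1, p1) ∨ v = (t2, p2)

/-- The type II corner condition: `R₁ ∩ V ⊆ {(θ₁,φ₂),(θ₂,φ₁)}`. -/
def TypeIICornerCond (R₁ : RectDiagram) (t1 t2 p1 p2 : Real.Angle) : Prop :=
  ∀ v ∈ R₁.verts, v ∈ corners t1 t2 p1 p2 → v = (t1, p2) ∨ v = (t2, p1)

/-- `R₁ ↦ R₂` is a type I stabilization. -/
def IsTypeIStab (R₁ R₂ : RectDiagram) : Prop :=
  ∃ t1 t2 p1 p2, IsStabWith R₁ R₂ t1 t2 p1 p2 ∧ TypeICornerCond R₁ t1 t2 p1 p2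

/-- `R₁ ↦ R₂` is a type II stabilization. -/
def IsTypeIIStab (R₁ R₂ : RectDiagram) : Prop :=
  ∃ t1 t2 p1 p2, IsStabWith R₁ R₂ t1 t2 p1 p2 ∧ TypeIICornerCond R₁ t1 t2 p1 p2

/-- `R₁ ↦ R₂` is a type I destabilization. -/
def IsTypeIDestab (R₁ R₂ : RectDiagram) : Prop := IsTypeIStab R₂ R₁

/-- `R₁ ↦ R₂` is a type II destabilization. -/
def IsTypeIIDestab (R₁ R₂ : RectDiagram) : Prop := IsTypeIIStab R₂ R₁

/-- The four oriented types `→I`, `←I`, `→II`, `←II` of (de)stabilizations. -/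
inductive OType
  | posI
  | negI
  | posII
  | negII
deriving DecidableEq

/-- Whether an oriented type is of (unoriented) type I. -/
def OType.isI : OType → Bool
  | .posI => true
  | .negI => true
  | _ => false

/-- `R₁ ↦ R₂` is a stabilization of the given oriented type. -/
def IsStabOfOType (R₁ R₂ : RectDiagram) (t : OType) : Prop :=
  ∃ t1 t2 p1 p2, IsStabWith R₁ R₂ t1 t2 p1 p2 ∧
    ∃ p0, (p0 = p1 ∨ p0 = p2) ∧ (t1, p0) ∈ R₂.verts ∧ (t2, p0) ∈ R₂.verts ∧
      (match t with
        | .posI => TypeICornerCond R₁ t1 t2 p1 p2 ∧ R₂.sgn (t2, p0) = true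
        | .negI => TypeICornerCond R₁ t1 t2 p1 p2 ∧ R₂.sgn (t2, p0) = false
        | .posII => TypeIICornerCond R₁ t1 t2 p1 p2 ∧ R₂.sgn (t2, p0) = true
        | .negII => TypeIICornerCond R₁ t1 t2 p1 p2 ∧ R₂.sgn (t2, p0) = false)

/-- `R₁ ↦ R₂` is a destabilization of the given oriented type. -/
def IsDestabOfOType (R₁ R₂ : RectDiagram) (t : OType) : Prop := IsStabOfOType R₂ R₁ t

/-- The move `R₁ ↦ R₂` is performed on (modifies) the connected component number `i`. -/
def ModifiesComp (R₁ R₂ : RectDiagram) (i : ℕ) : Prop :=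
  ∃ v ∈ R₁.verts, v ∉ R₂.verts ∧ R₁.comp v = i

/-- The kind of an elementary move: an exchange, a stabilization of oriented type `t`
on the component number `i`, or a destabilization of oriented type `t` on the component
number `i`. -/
inductive MoveKind
  | exchange
  | stab (t : OType) (i : ℕ)
  | destab (t : OType) (i : ℕ)
deriving DecidableEq

/-- The pair `(R₁, R₂)` is an elementary move realizing the given kind. -/
def KindOk (R₁ R₂ : RectDiagram) : MoveKind → Prop
  | .exchange => IsExchange R₁ R₂
  | .stab t i => IsStabOfOType R₁ R₂ t ∧ ModifiesComp R₁ R₂ i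
  | .destab t i => IsDestabOfOType R₁ R₂ t ∧ ModifiesComp R₁ R₂ i

/-- `LChain R s R'` : `s` is a chain of elementary moves from `R` to `R'`, each move
labeled by its kind. -/
def LChain : RectDiagram → List (MoveKind × RectDiagram) → RectDiagram → Prop
  | R, [], R' => R = R'
  | R, (k, S) :: rest, R' => KindOk R S k ∧ LChain S rest R'

theorem arcLen_nonneg (x y : Real.Angle) : 0 ≤ arcLen x y := by
  unfold arcLen
  have := Real.Angle.neg_pi_lt_toReal (y - x)
  split_ifs <;> linarith [Real.pi_pos]

theorem arcLen_lt (x y : Real.Angle) : arcLen x y < 2 * π := by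
  unfold arcLen
  have := Real.Angle.toReal_le_pi (y - x)
  split_ifs <;> linarith [Real.pi_pos]

theorem coe_arcLen (x y : Real.Angle) : ((arcLen x y : ℝ) : Real.Angle) = y - x := by
  unfold arcLen
  split_ifs <;> simp [Real.Angle.coe_add]

theorem eq_of_coe_eq {s t : ℝ} (h : (s : Real.Angle) = t) (hs : 0 ≤ s) (hs' : s < 2 * π)
    (ht : 0 ≤ t) (ht' : t < 2 * π) : s = t := by
  obtain ⟨k, hk⟩ := Real.Angle.angle_eq_iff_two_pi_dvd_sub.1 h
  have hp := Real.pi_pos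
  have h1 : (k : ℝ) < 1 := by
    by_contra hc
    push Not at hc
    nlinarith
  have h2 : (-1 : ℝ) < k := by
    by_contra hc
    push Not at hc
    nlinarith
  have h3 : k < 1 := by exact_mod_cast h1
  have h4 : -1 < k := by exact_mod_cast h2
  obtain rfl : k = 0 := by omega
  simp at hk
  linarith

theorem arcLen_add_coe (x : Real.Angle) {t : ℝ} (ht : 0 ≤ t) (ht' : t < 2 * π) :
    arcLen x (x + t) = t :=
  eq_of_coe_eq (by rw [coe_arcLen]; simp) (arcLen_nonneg _ _) (arcLen_lt _ _) ht ht'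

theorem arcLen_self (x : Real.Angle) : arcLen x x = 0 := by simp [arcLen]

theorem arcLen_pos {x y : Real.Angle} (h : x ≠ y) : 0 < arcLen x y := by
  refine lt_of_le_of_ne (arcLen_nonneg _ _) fun h0 => h ?_
  have := coe_arcLen x y
  rw [← h0, Real.Angle.coe_zero] at this
  exact (sub_eq_zero.1 this.symm).symm

theorem arcLen_triangle (x y z : Real.Angle) :
    arcLen x z = arcLen x y + arcLen y z ∨ arcLen x z = arcLen x y + arcLen y z - 2 * π := by
  have h1 := arcLen_nonneg x y
  have h2 := arcLen_nonneg y z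
  have h3 := arcLen_lt x y
  have h4 := arcLen_lt y z
  rcases lt_or_ge (arcLen x y + arcLen y z) (2 * π) with h | h
  · left
    refine eq_of_coe_eq ?_ (arcLen_nonneg _ _) (arcLen_lt _ _) (by linarith) h
    simp [Real.Angle.coe_add, coe_arcLen]
  · right
    refine eq_of_coe_eq ?_ (arcLen_nonneg _ _) (arcLen_lt _ _) (by linarith) (by linarith)
    rw [Real.Angle.coe_sub]
    simp [Real.Angle.coe_add, coe_arcLen]

theorem mem_Arc {x y z : Real.Angle} : z ∈ Arc x y ↔ arcLen x z ≤ arcLen x y := by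
  constructor
  · rintro ⟨t, h0, h1, rfl⟩
    rwa [arcLen_add_coe x h0 (h1.trans_lt (arcLen_lt _ _))]
  · intro h
    exact ⟨arcLen x z, arcLen_nonneg _ _, h, by simp [coe_arcLen]⟩

/-- The length of the arc running from `x` to `y` in the positive direction if `d` is `true`
and in the negative direction otherwise. -/
def dirLen (d : Bool) (x y : Real.Angle) : ℝ := if d then arcLen x y else arcLen y x

/-- The closed arc running from `x` to `y` in the positive direction if `d` is `true`
and in the negative direction otherwise. -/
def dirArc (d : Bool) (x y : Real.Angle) : Set Real.Angle := if d then Arc x y else Arc y x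

theorem dirLen_nonneg (d : Bool) (x y : Real.Angle) : 0 ≤ dirLen d x y := by
  cases d <;> exact arcLen_nonneg _ _

theorem dirLen_lt (d : Bool) (x y : Real.Angle) : dirLen d x y < 2 * π := by
  cases d <;> exact arcLen_lt _ _

theorem dirLen_self (d : Bool) (x : Real.Angle) : dirLen d x x = 0 := by
  cases d <;> exact arcLen_self _

theorem dirLen_pos (d : Bool) {x y : Real.Angle} (h : x ≠ y) : 0 < dirLen d x y := by
  cases d
  · exact arcLen_pos h.symm
  · exact arcLen_pos h

theorem dirLen_triangle (d : Bool) (x y z : Real.Angle) :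
    dirLen d x z = dirLen d x y + dirLen d y z ∨
      dirLen d x z = dirLen d x y + dirLen d y z - 2 * π := by
  cases d
  · have := arcLen_triangle z y x
    simp only [dirLen]
    rw [add_comm] at this
    exact this
  · exact arcLen_triangle x y z

theorem exists_dirLen_eq (d : Bool) (x : Real.Angle) {t : ℝ} (ht : 0 ≤ t) (ht' : t < 2 * π) :
    ∃ a, dirLen d x a = t := by
  cases d
  · refine ⟨x - t, ?_⟩
    have := arcLen_add_coe (x - t) ht ht'
    rwa [sub_add_cancel] at this
  · exact ⟨x + t, arcLen_add_coe x ht ht'⟩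

theorem mem_dirArc {d : Bool} {x y z : Real.Angle} :
    z ∈ dirArc d x y ↔ dirLen d x z ≤ dirLen d x y := by
  cases d
  · refine mem_Arc.trans ?_
    change arcLen y z ≤ arcLen y x ↔ arcLen z x ≤ arcLen y x
    have h1 := arcLen_nonneg y z
    have h2 := arcLen_nonneg z x
    have h3 := arcLen_lt y z
    have h4 := arcLen_lt z x
    have h5 := arcLen_nonneg y x
    rcases arcLen_triangle y z x with h | h
    · constructor <;> intro <;> linarith
    · constructor <;> intro <;> linarith
  · exact mem_Arc

theorem dirArc_not (d : Bool) (x y : Real.Angle) : dirArc (!d) x y = dirArc d y x := by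
  cases d <;> rfl

theorem left_mem_dirArc (d : Bool) (x y : Real.Angle) : x ∈ dirArc d x y := by
  rw [mem_dirArc, dirLen_self]; exact dirLen_nonneg _ _ _

theorem right_mem_dirArc (d : Bool) (x y : Real.Angle) : y ∈ dirArc d x y := mem_dirArc.2 le_rfl

theorem mem_dirArc_of_notMem {d : Bool} {x a z : Real.Angle} (h : z ∉ dirArc d x a) :
    a ∈ dirArc d x z := by
  rw [mem_dirArc] at *; linarith

theorem dirArc_subset {d : Bool} {x a a' : Real.Angle} (h : a' ∈ dirArc d x a) :
    dirArc d x a' ⊆ dirArc d x a := by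
  intro z hz
  rw [mem_dirArc] at *; linarith

theorem dirArc_subset' {d : Bool} {x a a' : Real.Angle} (h : a' ∈ dirArc d x a) :
    dirArc d a' a ⊆ dirArc d x a := by
  have := dirArc_subset (d := !d) (x := a) (a := x) (a' := a') (by rwa [dirArc_not])
  rwa [dirArc_not, dirArc_not] at this

theorem notMem_dirArc {d : Bool} {x a a' : Real.Angle} (h : a' ∈ dirArc d x a) (hx : a' ≠ x) :
    x ∉ dirArc d a' a := by
  rw [mem_dirArc] at *
  have h0 := dirLen_pos d hx
  have h1 := dirLen_pos d hx.symm
  have h2 := dirLen_lt d x a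
  have h3 := dirLen_lt d a' a
  have h4 := dirLen_nonneg d x a
  have h5 := dirLen_nonneg d a' a
  have h6 := dirLen_triangle d a' x a
  have h7 := dirLen_triangle d x a' a
  have h8 := dirLen_triangle d x a' x
  rw [dirLen_self] at h8
  intro h9
  rcases h6 with h6 | h6 <;> rcases h7 with h7 | h7 <;> rcases h8 with h8 | h8 <;> linarith

theorem exists_near (d : Bool) (x : Real.Angle) (F : Finset Real.Angle) :
    ∃ a, a ≠ x ∧ ∀ z ∈ F, z ∈ dirArc d x a → z = x := by
  have hpi := Real.pi_pos
  have key : ∃ δ : ℝ, 0 < δ ∧ δ < 2 * π ∧ ∀ z ∈ F, z ≠ x → δ < dirLen d x z := by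
    induction F using Finset.induction_on with
    | empty => exact ⟨π, by linarith, by linarith, by simp⟩
    | insert y F _ ih =>
      obtain ⟨δ, h0, h1, h2⟩ := ih
      by_cases hy : y = x
      · refine ⟨δ, h0, h1, fun z hz hzx => ?_⟩
        rcases Finset.mem_insert.1 hz with rfl | hz
        · exact absurd hy hzx
        · exact h2 z hz hzx
      · have hp := dirLen_pos d (Ne.symm hy)
        refine ⟨min δ (dirLen d x y / 2), lt_min h0 (by linarith),
          (min_le_left _ _).trans_lt h1, fun z hz hzx => ?_⟩
        rcases Finset.mem_insert.1 hz with rfl | hz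
        · exact (min_le_right _ _).trans_lt (by linarith)
        · exact (min_le_left _ _).trans_lt (h2 z hz hzx)
  obtain ⟨δ, h0, h1, h2⟩ := key
  obtain ⟨a, ha⟩ := exists_dirLen_eq d x h0.le h1
  refine ⟨a, ?_, fun z hz hza => ?_⟩
  · rintro rfl
    rw [dirLen_self] at ha
    linarith
  · by_contra hzx
    have := h2 z hz hzx
    rw [mem_dirArc] at hza
    linarith

section Vertices

variable {R S : RectDiagram} {u v w : Torus}

theorem MeridianOK.exists_partner {V : Finset Torus} {sgn : Torus → Bool} (h : MeridianOK V sgn)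
    (hu : u ∈ V) : ∃ w ∈ V, w ≠ u ∧ w.1 = u.1 ∧ sgn w ≠ sgn u ∧
      ∀ x ∈ V, x.1 = u.1 → x = u ∨ x = w := by
  rcases h u.1 with h | ⟨p, q, hp, hq, hpq, h1, h2, h3, h4⟩
  · exact absurd rfl (h u hu)
  · rcases h4 u hu rfl with rfl | rfl
    · exact ⟨q, hq, hpq.symm, h2, h3.symm, h4⟩
    · exact ⟨p, hp, hpq, h1, h3, fun x hx hxu => (h4 x hx hxu).symm⟩

theorem LongitudeOK.exists_partner {V : Finset Torus} {sgn : Torus → Bool}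
    (h : LongitudeOK V sgn) (hu : u ∈ V) : ∃ w ∈ V, w ≠ u ∧ w.2 = u.2 ∧ sgn w ≠ sgn u ∧
      ∀ x ∈ V, x.2 = u.2 → x = u ∨ x = w := by
  rcases h u.2 with h | ⟨p, q, hp, hq, hpq, h1, h2, h3, h4⟩
  · exact absurd rfl (h u hu)
  · rcases h4 u hu rfl with rfl | rfl
    · exact ⟨q, hq, hpq.symm, h2, h3.symm, h4⟩
    · exact ⟨p, hp, hpq, h1, h3, fun x hx hxu => (h4 x hx hxu).symm⟩

theorem meridianOK_of_partner {V : Finset Torus} {sgn : Torus → Bool}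
    (h : ∀ u ∈ V, ∃ w ∈ V, w ≠ u ∧ w.1 = u.1 ∧ sgn w ≠ sgn u ∧
      ∀ x ∈ V, x.1 = u.1 → x = u ∨ x = w) : MeridianOK V sgn := by
  intro θ
  by_cases hθ : ∀ v ∈ V, v.1 ≠ θ
  · exact Or.inl hθ
  · push Not at hθ
    obtain ⟨u, hu, rfl⟩ := hθ
    obtain ⟨w, hw, h1, h2, h3, h4⟩ := h u hu
    exact Or.inr ⟨u, w, hu, hw, h1.symm, rfl, h2, h3.symm, h4⟩

theorem longitudeOK_of_partner {V : Finset Torus} {sgn : Torus → Bool}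
    (h : ∀ u ∈ V, ∃ w ∈ V, w ≠ u ∧ w.2 = u.2 ∧ sgn w ≠ sgn u ∧
      ∀ x ∈ V, x.2 = u.2 → x = u ∨ x = w) : LongitudeOK V sgn := by
  intro θ
  by_cases hθ : ∀ v ∈ V, v.2 ≠ θ
  · exact Or.inl hθ
  · push Not at hθ
    obtain ⟨u, hu, rfl⟩ := hθ
    obtain ⟨w, hw, h1, h2, h3, h4⟩ := h u hu
    exact Or.inr ⟨u, w, hu, hw, h1.symm, rfl, h2, h3.symm, h4⟩

theorem sgn_ne_of_isEdge (h : IsEdge R u v) : R.sgn u ≠ R.sgn v := by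
  obtain ⟨hu, hv, hne, h | h⟩ := h
  · obtain ⟨w, -, -, -, h3, h4⟩ := R.diag.1.exists_partner hu
    rcases h4 v hv h.symm with rfl | rfl
    · exact absurd rfl hne
    · exact h3.symm
  · obtain ⟨w, -, -, -, h3, h4⟩ := R.diag.2.exists_partner hu
    rcases h4 v hv h.symm with rfl | rfl
    · exact absurd rfl hne
    · exact h3.symm

theorem mem_of_isEdge {T : Finset Torus} (hT : IsDiagSet T R.sgn) (hTR : T ⊆ R.verts)
    (h : IsEdge R u v) (hu : u ∈ T) : v ∈ T := by
  obtain ⟨huR, hv, hne, h | h⟩ := h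
  · obtain ⟨w, hw, h1, h2, -, -⟩ := hT.1.exists_partner hu
    obtain ⟨w', -, -, -, -, h4⟩ := R.diag.1.exists_partner huR
    rcases h4 v hv h.symm with rfl | rfl
    · exact absurd rfl hne
    · rcases h4 w (hTR hw) h2 with rfl | rfl
      · exact absurd rfl h1
      · exact hw
  · obtain ⟨w, hw, h1, h2, -, -⟩ := hT.2.exists_partner hu
    obtain ⟨w', -, -, -, -, h4⟩ := R.diag.2.exists_partner huR
    rcases h4 v hv h.symm with rfl | rfl
    · exact absurd rfl hne
    · rcases h4 w (hTR hw) h2 with rfl | rfl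
      · exact absurd rfl h1
      · exact hw

theorem comp_eq_of_isEdge (h : IsEdge R u v) : R.comp u = R.comp v := by
  obtain ⟨T, hT, huT, -⟩ := (R.comp_eq_iff u h.1 u h.1).1 rfl
  exact (R.comp_eq_iff u h.1 v h.2.1).2 ⟨T, hT, huT, mem_of_isEdge hT.2.2.1 hT.1 h huT⟩

theorem eq_or_eq_of_fst_eq {x : Torus} (hu : u ∈ R.verts) (hv : v ∈ R.verts) (hx : x ∈ R.verts)
    (huv : u ≠ v) (h : u.1 = v.1) (hxu : x.1 = u.1) : x = u ∨ x = v := by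
  obtain ⟨w, -, -, -, -, h4⟩ := R.diag.1.exists_partner hu
  rcases h4 v hv h.symm with rfl | rfl
  · exact absurd rfl huv
  · exact h4 x hx hxu

theorem eq_or_eq_of_snd_eq {x : Torus} (hu : u ∈ R.verts) (hv : v ∈ R.verts) (hx : x ∈ R.verts)
    (huv : u ≠ v) (h : u.2 = v.2) (hxu : x.2 = u.2) : x = u ∨ x = v := by
  obtain ⟨w, -, -, -, -, h4⟩ := R.diag.2.exists_partner hu
  rcases h4 v hv h.symm with rfl | rfl
  · exact absurd rfl huv
  · exact h4 x hx hxu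

/-- Vertices of the same component are joined by a path of edges. -/
theorem reflTransGen_isEdge (hu : u ∈ R.verts) (hv : v ∈ R.verts) (h : R.comp u = R.comp v) :
    Relation.ReflTransGen (IsEdge R) u v := by
  classical
  obtain ⟨T, hT, huT, hvT⟩ := (R.comp_eq_iff u hu v hv).1 h
  have hTT : T.filter (Relation.ReflTransGen (IsEdge R) u) = T := by
    refine hT.2.2.2 _ (Finset.filter_subset _ _) ⟨u, Finset.mem_filter.2 ⟨huT, .refl⟩⟩ ⟨?_, ?_⟩
    · refine meridianOK_of_partner fun x hx => ?_
      obtain ⟨hxT, hux⟩ := Finset.mem_filter.1 hx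
      obtain ⟨w, hw, h1, h2, h3, h4⟩ := hT.2.2.1.1.exists_partner hxT
      exact ⟨w, Finset.mem_filter.2 ⟨hw, hux.tail ⟨hT.1 hxT, hT.1 hw, h1.symm, .inl h2.symm⟩⟩,
        h1, h2, h3, fun y hy => h4 y (Finset.mem_filter.1 hy).1⟩
    · refine longitudeOK_of_partner fun x hx => ?_
      obtain ⟨hxT, hux⟩ := Finset.mem_filter.1 hx
      obtain ⟨w, hw, h1, h2, h3, h4⟩ := hT.2.2.1.2.exists_partner hxT
      exact ⟨w, Finset.mem_filter.2 ⟨hw, hux.tail ⟨hT.1 hxT, hT.1 hw, h1.symm, .inr h2.symm⟩⟩,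
        h1, h2, h3, fun y hy => h4 y (Finset.mem_filter.1 hy).1⟩
  rw [← hTT] at hvT
  exact (Finset.mem_filter.1 hvT).2

end Vertices

section Map

/-- Bijections of the torus which preserve both families of circles, possibly exchanging
the two families. -/
def PreservesCircles (e : Torus ≃ Torus) : Prop :=
  (∀ u v, ((e u).1 = (e v).1 ↔ u.1 = v.1) ∧ ((e u).2 = (e v).2 ↔ u.2 = v.2)) ∨
    ∀ u v, ((e u).1 = (e v).1 ↔ u.2 = v.2) ∧ ((e u).2 = (e v).2 ↔ u.1 = v.1)

theorem PreservesCircles.symm {e : Torus ≃ Torus} (he : PreservesCircles e) :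
    PreservesCircles e.symm := by
  rcases he with he | he
  · left
    intro u v
    have := he (e.symm u) (e.symm v)
    simp only [Equiv.apply_symm_apply] at this
    exact ⟨this.1.symm, this.2.symm⟩
  · right
    intro u v
    have := he (e.symm u) (e.symm v)
    simp only [Equiv.apply_symm_apply] at this
    exact ⟨this.2.symm, this.1.symm⟩

theorem IsDiagSet.map {V : Finset Torus} {sgn : Torus → Bool} (h : IsDiagSet V sgn)
    {e : Torus ≃ Torus} (he : PreservesCircles e) :
    IsDiagSet (V.map e.toEmbedding) (sgn ∘ e.symm) := by
  rcases he with he | he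
  · constructor
    · refine meridianOK_of_partner fun u hu => ?_
      obtain ⟨u, hu', rfl⟩ := Finset.mem_map.1 hu
      obtain ⟨w, hw, h1, h2, h3, h4⟩ := h.1.exists_partner hu'
      refine ⟨e w, Finset.mem_map.2 ⟨w, hw, rfl⟩, by simpa using h1, (he w u).1.2 h2,
        by simpa using h3, fun x hx hxu => ?_⟩
      obtain ⟨x, hx', rfl⟩ := Finset.mem_map.1 hx
      simpa using h4 x hx' ((he x u).1.1 hxu)
    · refine longitudeOK_of_partner fun u hu => ?_
      obtain ⟨u, hu', rfl⟩ := Finset.mem_map.1 hu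
      obtain ⟨w, hw, h1, h2, h3, h4⟩ := h.2.exists_partner hu'
      refine ⟨e w, Finset.mem_map.2 ⟨w, hw, rfl⟩, by simpa using h1, (he w u).2.2 h2,
        by simpa using h3, fun x hx hxu => ?_⟩
      obtain ⟨x, hx', rfl⟩ := Finset.mem_map.1 hx
      simpa using h4 x hx' ((he x u).2.1 hxu)
  · constructor
    · refine meridianOK_of_partner fun u hu => ?_
      obtain ⟨u, hu', rfl⟩ := Finset.mem_map.1 hu
      obtain ⟨w, hw, h1, h2, h3, h4⟩ := h.2.exists_partner hu'
      refine ⟨e w, Finset.mem_map.2 ⟨w, hw, rfl⟩, by simpa using h1, (he w u).1.2 h2,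
        by simpa using h3, fun x hx hxu => ?_⟩
      obtain ⟨x, hx', rfl⟩ := Finset.mem_map.1 hx
      simpa using h4 x hx' ((he x u).1.1 hxu)
    · refine longitudeOK_of_partner fun u hu => ?_
      obtain ⟨u, hu', rfl⟩ := Finset.mem_map.1 hu
      obtain ⟨w, hw, h1, h2, h3, h4⟩ := h.1.exists_partner hu'
      refine ⟨e w, Finset.mem_map.2 ⟨w, hw, rfl⟩, by simpa using h1, (he w u).2.2 h2,
        by simpa using h3, fun x hx hxu => ?_⟩
      obtain ⟨x, hx', rfl⟩ := Finset.mem_map.1 hx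
      simpa using h4 x hx' ((he x u).2.1 hxu)

theorem map_symm_map (e : Torus ≃ Torus) (V : Finset Torus) :
    (V.map e.toEmbedding).map e.symm.toEmbedding = V := by
  ext u; simp

theorem IsComponent.map {V T : Finset Torus} {sgn : Torus → Bool} (h : IsComponent V sgn T)
    {e : Torus ≃ Torus} (he : PreservesCircles e) :
    IsComponent (V.map e.toEmbedding) (sgn ∘ e.symm) (T.map e.toEmbedding) := by
  obtain ⟨h1, h2, h3, h4⟩ := h
  refine ⟨Finset.map_subset_map.2 h1, h2.map, h3.map he, fun T' hT' hne hd => ?_⟩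
  have hd' := hd.map he.symm
  have := h4 (T'.map e.symm.toEmbedding) ?_ hne.map ?_
  · rw [← this]
    exact (map_symm_map e.symm T').symm
  · rw [← map_symm_map e T]
    exact Finset.map_subset_map.2 hT'
  · convert hd' using 1
    funext u
    simp

/-- The image of a diagram under a bijection of the torus preserving the circles. -/
def RectDiagram.map (R : RectDiagram) (e : Torus ≃ Torus) (he : PreservesCircles e) :
    RectDiagram where
  verts := R.verts.map e.toEmbedding
  sgn := R.sgn ∘ e.symm
  comp := R.comp ∘ e.symm
  diag := R.diag.map he
  comp_eq_iff := by
    intro u hu v hv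
    obtain ⟨u, hu', rfl⟩ := Finset.mem_map.1 hu
    obtain ⟨v, hv', rfl⟩ := Finset.mem_map.1 hv
    have h := R.comp_eq_iff u hu' v hv'
    simp only [Equiv.coe_toEmbedding, Function.comp, Equiv.symm_apply_apply]
    rw [h]
    constructor
    · rintro ⟨T, hT, h1, h2⟩
      exact ⟨T.map e.toEmbedding, hT.map he, by simpa using h1, by simpa using h2⟩
    · rintro ⟨T, hT, h1, h2⟩
      refine ⟨T.map e.symm.toEmbedding, ?_, by simpa using h1, by simpa using h2⟩
      have := hT.map he.symm
      rw [map_symm_map] at this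
      convert this using 1
      funext u
      simp

/-- The bijection of the torus exchanging the meridians of `x` and `y`. -/
def swapMeridians (x y : Real.Angle) : Torus ≃ Torus :=
  Equiv.prodCongr (Equiv.swap x y) (Equiv.refl _)

theorem preservesCircles_swapMeridians (x y : Real.Angle) :
    PreservesCircles (swapMeridians x y) := by
  left
  intro u v
  simp [swapMeridians]

theorem preservesCircles_prodComm :
    PreservesCircles (Equiv.prodComm Real.Angle Real.Angle) := by
  right
  intro u v
  simp

namespace RectDiagram

variable (R : RectDiagram)

/-- The diagram obtained by exchanging the meridians of `x` and `y`. -/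
def swapFst (x y : Real.Angle) : RectDiagram :=
  R.map (swapMeridians x y) (preservesCircles_swapMeridians x y)

/-- The diagram obtained by exchanging the two coordinates. -/
def transpose : RectDiagram := R.map (Equiv.prodComm _ _) preservesCircles_prodComm

variable {R}

theorem mem_swapFst {x y : Real.Angle} {u : Torus} :
    u ∈ (R.swapFst x y).verts ↔ (Equiv.swap x y u.1, u.2) ∈ R.verts := by
  refine Finset.mem_map_equiv.trans ?_
  rfl

theorem sgn_swapFst (x y : Real.Angle) (u : Torus) :
    (R.swapFst x y).sgn u = R.sgn (Equiv.swap x y u.1, u.2) := rfl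

theorem comp_swapFst (x y : Real.Angle) (u : Torus) :
    (R.swapFst x y).comp u = R.comp (Equiv.swap x y u.1, u.2) := rfl

theorem mem_transpose {u : Torus} : u ∈ R.transpose.verts ↔ u.swap ∈ R.verts := by
  refine Finset.mem_map_equiv.trans ?_
  simp

/-- Two diagrams with the same vertices, signs and component numbers. -/
structure Same (R S : RectDiagram) : Prop where
  verts : R.verts = S.verts
  agree : ∀ u ∈ R.verts, R.sgn u = S.sgn u ∧ R.comp u = S.comp u

theorem Same.symm {S : RectDiagram} (h : Same R S) : Same S R :=
  ⟨h.verts.symm, fun u hu =>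
    ⟨(h.agree u (h.verts ▸ hu)).1.symm, (h.agree u (h.verts ▸ hu)).2.symm⟩⟩

theorem same_transpose_transpose (R : RectDiagram) : Same R.transpose.transpose R :=
  ⟨by ext u; simp [mem_transpose], fun _ _ => ⟨rfl, rfl⟩⟩

end RectDiagram

end Map

section Exchange

variable {R S : RectDiagram}

theorem mem_corners {t1 t2 p1 p2 : Real.Angle} {u : Torus} :
    u ∈ corners t1 t2 p1 p2 ↔ (u.1 = t1 ∨ u.1 = t2) ∧ (u.2 = p1 ∨ u.2 = p2) := by
  obtain ⟨a, b⟩ := u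
  simp only [corners, Finset.mem_insert, Finset.mem_singleton, Prod.mk.injEq]
  tauto

theorem IsExchange.symm (h : IsExchange R S) : IsExchange S R := by
  obtain ⟨⟨t1, t2, p1, p2, h1, h2, h3, ⟨u, v, hu, hv, h4⟩, h5, h6, h7, h8⟩, h9⟩ := h
  refine ⟨⟨t1, t2, p1, p2, h1, h2, by rwa [symmDiff_comm], ⟨u, v, ?_, ?_, h4.symm⟩, h6, h5, ?_,
    fun w hw => ?_⟩, h9.symm⟩
  · rwa [symmDiff_comm]
  · rwa [symmDiff_comm]
  · rwa [Set.union_comm]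
  · rw [Finset.inter_comm] at hw
    exact ⟨(h8 w hw).1.symm, (h8 w hw).2.symm⟩

theorem IsExchange.congr_right {S' : RectDiagram} (h : IsExchange R S) (hS : S.Same S') :
    IsExchange R S' := by
  obtain ⟨⟨t1, t2, p1, p2, h1, h2, h3, h4, h5, h6, h7, h8⟩, h9⟩ := h
  refine ⟨⟨t1, t2, p1, p2, h1, h2, ?_, ?_, ?_, ?_, ?_, fun w hw => ?_⟩, ?_⟩
  · rwa [← hS.verts]
  · simpa only [IsEdge, ← hS.verts] using h4
  · rwa [← hS.verts]
  · rwa [← hS.verts]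
  · rwa [← hS.verts]
  · rw [← hS.verts] at hw
    have := hS.agree w (Finset.mem_inter.1 hw).2
    rw [← this.1, ← this.2]
    exact h8 w hw
  · rwa [← hS.verts]

theorem IsExchange.transpose (h : IsExchange R S) : IsExchange R.transpose S.transpose := by
  obtain ⟨⟨t1, t2, p1, p2, h1, h2, h3, ⟨u, v, hu, hv, h4⟩, h5, h6, h7, h8⟩, h9⟩ := h
  have hsd : ∀ u : Torus, u ∈ symmDiff R.transpose.verts S.transpose.verts ↔
      u.swap ∈ symmDiff R.verts S.verts := by
    intro u
    simp only [Finset.mem_symmDiff, RectDiagram.mem_transpose]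
  have hsub : ∀ {R S : RectDiagram}, R.transpose.verts ⊆ S.transpose.verts →
      R.verts ⊆ S.verts := by
    intro R S h u hu
    have := h ((RectDiagram.mem_transpose (u := u.swap)).2 (by simpa using hu))
    simpa [RectDiagram.mem_transpose] using this
  have hed : ∀ {R : RectDiagram}, IsEdge R u v → IsEdge R.transpose u.swap v.swap := by
    intro R h
    exact ⟨RectDiagram.mem_transpose.2 (by simpa using h.1),
      RectDiagram.mem_transpose.2 (by simpa using h.2.1), by simpa using h.2.2.1, h.2.2.2.symm⟩
  refine ⟨⟨p1, p2, t1, t2, h2, h1, ?_, ⟨u.swap, v.swap, ?_, ?_, h4.imp hed hed⟩,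
    fun h => h5 (hsub h), fun h => h6 (hsub h), ?_, fun w hw => ?_⟩, ?_⟩
  · ext u
    rw [hsd, h3, mem_corners, mem_corners]
    exact and_comm
  · rw [hsd]; simpa using hu
  · rw [hsd]; simpa using hv
  · ext u
    have := Set.ext_iff.1 h7 u.swap
    simp only [Set.mem_inter_iff, Set.mem_union, Finset.mem_coe, RectSet, Set.mem_ofPred_eq,
      mem_corners, RectDiagram.mem_transpose, Prod.fst_swap, Prod.snd_swap] at this ⊢
    rw [and_comm (a := _ ∈ Arc p1 p2), this, and_comm]
  · simp only [Finset.mem_inter, RectDiagram.mem_transpose] at hw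
    exact h8 w.swap (Finset.mem_inter.2 hw)
  · simpa [RectDiagram.transpose, RectDiagram.map] using h9

/-- Moving the vertical edge `{x} × {p, q}` to the free meridian of `y` is an exchange move
provided that one of the rectangles swept by the edge contains no other vertices. -/
theorem isExchange_swapFst {x y p q : Real.Angle} (d d' : Bool)
    (hp : (x, p) ∈ S.verts) (hq : (x, q) ∈ S.verts) (hpq : p ≠ q)
    (hy : ∀ u ∈ S.verts, u.1 ≠ y)
    (h : ∀ u ∈ S.verts, u.1 ∈ dirArc d x y → u.2 ∈ dirArc d' p q → u.1 = x) :
    IsExchange S (S.swapFst x y) := by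
  have hxy : x ≠ y := hy _ hp
  have hx : ∀ u ∈ S.verts, u.1 = x → u.2 = p ∨ u.2 = q := by
    intro u hu hux
    rcases eq_or_eq_of_fst_eq hp hq hu (by simpa using hpq) rfl hux with rfl | rfl <;> simp
  have hT : ∀ u : Torus, u ∈ (S.swapFst x y).verts ↔
      (u ∈ S.verts ∧ u.1 ≠ x) ∨ (u.1 = y ∧ (u.2 = p ∨ u.2 = q)) := by
    rintro ⟨a, b⟩
    rw [RectDiagram.mem_swapFst]
    by_cases hax : a = x
    · subst hax
      simp only [Equiv.swap_apply_left, ne_eq, not_true_eq_false, and_false, false_or]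
      exact ⟨fun hh => absurd rfl (hy _ hh), fun hh => absurd hh.1 hxy⟩
    · by_cases hay : a = y
      · subst hay
        simp only [Equiv.swap_apply_right, ne_eq, hax, not_false_eq_true, and_true, true_and]
        constructor
        · exact fun hh => Or.inr (hx _ hh rfl)
        · rintro (hh | rfl | rfl)
          · exact absurd rfl (hy _ hh)
          · exact hp
          · exact hq
      · simp [Equiv.swap_apply_of_ne_of_ne hax hay, hax, hay]
  have hS : ∀ u : Torus, u.1 = x → (u ∈ S.verts ↔ (u.2 = p ∨ u.2 = q)) := by
    rintro ⟨a, b⟩ rfl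
    exact ⟨fun hu => hx _ hu rfl, by rintro (rfl | rfl); exacts [hp, hq]⟩
  have key : ∀ t1 t2 p1 p2, (t1 = x ∧ t2 = y ∨ t1 = y ∧ t2 = x) →
      (p1 = p ∧ p2 = q ∨ p1 = q ∧ p2 = p) →
      (∀ u ∈ S.verts, u.1 ∈ Arc t1 t2 → u.2 ∈ Arc p1 p2 → u.1 = x) →
      IsElemMoveWith S (S.swapFst x y) t1 t2 p1 p2 := by
    intro t1 t2 p1 p2 ht hp12 hE
    have hc : ∀ u : Torus, u ∈ corners t1 t2 p1 p2 ↔ (u.1 = x ∨ u.1 = y) ∧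
        (u.2 = p ∨ u.2 = q) := by
      intro u
      rw [mem_corners]
      rcases ht with ⟨rfl, rfl⟩ | ⟨rfl, rfl⟩ <;> rcases hp12 with ⟨rfl, rfl⟩ | ⟨rfl, rfl⟩ <;>
        grind
    have hsd : symmDiff S.verts (S.swapFst x y).verts = corners t1 t2 p1 p2 := by
      ext u
      rw [hc, Finset.mem_symmDiff, hT]
      have := hS u
      have := hy u
      grind
    refine ⟨?_, ?_, hsd, ⟨(x, p), (x, q), ?_, ?_, .inl ⟨hp, hq, by simpa using hpq, .inl rfl⟩⟩,
      ?_, ?_, ?_, fun u hu => ?_⟩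
    · rcases ht with ⟨rfl, rfl⟩ | ⟨rfl, rfl⟩
      exacts [hxy, hxy.symm]
    · rcases hp12 with ⟨rfl, rfl⟩ | ⟨rfl, rfl⟩
      exacts [hpq, hpq.symm]
    · rw [hsd, hc]; simp
    · rw [hsd, hc]; simp
    · intro hh
      have := (hT _).1 (hh hp)
      simp [hxy] at this
    · intro hh
      exact hy (y, p) (hh ((hT _).2 (by simp))) rfl
    · ext u
      simp only [Set.mem_inter_iff, Set.mem_union, Finset.mem_coe, RectSet, Set.mem_ofPred_eq, hc,
        hT]
      constructor
      · rintro ⟨⟨h1, h2⟩, h3 | ⟨h3, h4⟩ | ⟨h3, h4⟩⟩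
        · have := hE u h3 h1 h2
          exact ⟨.inl this, hx u h3 this⟩
        · exact absurd (hE u h3 h1 h2) h4
        · exact ⟨.inr h3, h4⟩
      · rintro ⟨h1, h2⟩
        refine ⟨⟨?_, ?_⟩, ?_⟩
        · have e1 := left_mem_dirArc true t1 t2
          have e2 := right_mem_dirArc true t1 t2
          change t1 ∈ Arc t1 t2 at e1
          change t2 ∈ Arc t1 t2 at e2
          rcases ht with ⟨rfl, rfl⟩ | ⟨rfl, rfl⟩ <;> rcases h1 with h1 | h1 <;> rw [h1] <;>
            assumption
        · have e1 := left_mem_dirArc true p1 p2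
          have e2 := right_mem_dirArc true p1 p2
          change p1 ∈ Arc p1 p2 at e1
          change p2 ∈ Arc p1 p2 at e2
          rcases hp12 with ⟨rfl, rfl⟩ | ⟨rfl, rfl⟩ <;> rcases h2 with h2 | h2 <;> rw [h2] <;>
            assumption
        · rcases h1 with h1 | h1
          · exact .inl ((hS u h1).2 h2)
          · exact .inr (.inr ⟨h1, h2⟩)
    · obtain ⟨h1, h2⟩ := Finset.mem_inter.1 hu
      have hux : u.1 ≠ x := by
        rcases (hT u).1 h2 with h3 | h3
        · exact h3.2
        · exact absurd h3.1 (hy u h1)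
      rw [RectDiagram.sgn_swapFst, RectDiagram.comp_swapFst,
        Equiv.swap_apply_of_ne_of_ne hux (hy u h1)]
      exact ⟨rfl, rfl⟩
  refine ⟨?_, by simp [RectDiagram.swapFst, RectDiagram.map]⟩
  cases d <;> cases d'
  · exact ⟨y, x, q, p, key _ _ _ _ (.inr ⟨rfl, rfl⟩) (.inr ⟨rfl, rfl⟩) h⟩
  · exact ⟨y, x, p, q, key _ _ _ _ (.inr ⟨rfl, rfl⟩) (.inl ⟨rfl, rfl⟩) h⟩
  · exact ⟨x, y, q, p, key _ _ _ _ (.inl ⟨rfl, rfl⟩) (.inr ⟨rfl, rfl⟩) h⟩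
  · exact ⟨x, y, p, q, key _ _ _ _ (.inl ⟨rfl, rfl⟩) (.inl ⟨rfl, rfl⟩) h⟩

/-- Two diagrams are exchange equivalent if they are related by a chain of exchange moves. -/
abbrev ExchangeEquiv (R S : RectDiagram) : Prop := Relation.ReflTransGen IsExchange R S

theorem ExchangeEquiv.symm (h : ExchangeEquiv R S) : ExchangeEquiv S R :=
  by
  induction h with
  | refl => exact .refl
  | tail _ h ih => exact .head h.symm ih

theorem ExchangeEquiv.transpose (h : ExchangeEquiv R S) :
    ExchangeEquiv R.transpose S.transpose := by
  induction h with
  | refl => exact .refl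
  | tail _ h ih => exact ih.tail h.transpose

theorem RectDiagram.Same.exchangeEquiv (h : R.Same S) (hne : R.verts.Nonempty) :
    ExchangeEquiv R S := by
  obtain ⟨u, hu⟩ := hne
  obtain ⟨w, hw, hwu, h1, -, -⟩ := R.diag.1.exists_partner hu
  obtain ⟨y, hyu, hy⟩ := exists_near true u.1 (R.verts.image Prod.fst)
  have hy' : ∀ v ∈ R.verts, v.1 ∈ dirArc true u.1 y → v.1 = u.1 :=
    fun v hv => hy _ (Finset.mem_image_of_mem _ hv)
  have hex : IsExchange R (R.swapFst u.1 y) := by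
    refine isExchange_swapFst (p := u.2) (q := w.2) true true hu (by rw [← h1]; exact hw) ?_ ?_
      fun v hv h1 _ => hy' v hv h1
    · exact fun h2 => hwu (Prod.ext h1 h2.symm)
    · intro v hv hvy
      exact hyu (hvy.symm.trans (hy' v hv (hvy ▸ right_mem_dirArc _ _ _)))
  exact .head hex (.single (hex.symm.congr_right h))

theorem exchangeEquiv_of_transpose (hR : R.verts.Nonempty) {T : RectDiagram}
    (h : ExchangeEquiv R.transpose T) : ExchangeEquiv R T.transpose := by
  exact ((RectDiagram.same_transpose_transpose R).symm.exchangeEquiv hR).trans h.transpose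

end Exchange

section Stabilization

variable {R S : RectDiagram} {v : Torus} {a b : Real.Angle}

/-- `S` is obtained from `R` by replacing the vertex `v` with the other three vertices of a
rectangle with opposite corners `v` and `(a, b)`. -/
structure IsStabAt (R S : RectDiagram) (v : Torus) (a b : Real.Angle) : Prop where
  mem : v ∈ R.verts
  fst_ne : ∀ u ∈ R.verts, u.1 ≠ a
  snd_ne : ∀ u ∈ R.verts, u.2 ≠ b
  mem_iff : ∀ u, u ∈ S.verts ↔
    (u ∈ R.verts ∧ u ≠ v) ∨ u = (a, v.2) ∨ u = (v.1, b) ∨ u = (a, b)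
  agree : ∀ u ∈ R.verts, u ≠ v → S.sgn u = R.sgn u ∧ S.comp u = R.comp u

namespace IsStabAt

theorem transpose (h : IsStabAt R S v a b) :
    IsStabAt R.transpose S.transpose v.swap b a where
  mem := RectDiagram.mem_transpose.2 (by simpa using h.mem)
  fst_ne u hu := h.snd_ne u.swap (RectDiagram.mem_transpose.1 hu)
  snd_ne u hu := h.fst_ne u.swap (RectDiagram.mem_transpose.1 hu)
  mem_iff u := by
    rw [RectDiagram.mem_transpose, RectDiagram.mem_transpose, h.mem_iff]
    obtain ⟨x, y⟩ := u
    obtain ⟨z, w⟩ := v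
    simp only [Prod.swap_prod_mk, Prod.mk.injEq, ne_eq]
    tauto
  agree u hu huv := h.agree u.swap (RectDiagram.mem_transpose.1 hu)
    fun hh => huv (by rw [← hh, Prod.swap_swap])

theorem of_transpose (h : IsStabAt R.transpose S v.swap b a) :
    IsStabAt R S.transpose v a b := by
  have h' := h.transpose
  rw [Prod.swap_swap] at h'
  have hR := RectDiagram.same_transpose_transpose R
  exact ⟨hR.verts ▸ h'.mem, hR.verts ▸ h'.fst_ne, hR.verts ▸ h'.snd_ne, hR.verts ▸ h'.mem_iff,
    fun u hu => h'.agree u (hR.verts.symm ▸ hu)⟩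

theorem isEdge_partner_snd (h : IsStabAt R S v a b) :
    ∃ w, w ≠ v ∧ IsEdge R w v ∧ IsEdge S w (a, v.2) := by
  obtain ⟨w, hw, h1, h2, -, -⟩ := R.diag.2.exists_partner h.mem
  refine ⟨w, h1, ⟨hw, h.mem, h1, .inr h2⟩, (h.mem_iff _).2 (.inl ⟨hw, h1⟩),
    (h.mem_iff _).2 (by simp), ?_, .inr h2⟩
  rintro rfl
  exact h.fst_ne _ hw rfl

theorem isEdge_corner (h : IsStabAt R S v a b) : IsEdge S (a, v.2) (a, b) := by
  refine ⟨(h.mem_iff _).2 (by simp), (h.mem_iff _).2 (by simp), ?_, .inl rfl⟩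
  simpa using h.snd_ne v h.mem

theorem agree_horizontal (h : IsStabAt R S v a b) :
    S.sgn (a, v.2) = R.sgn v ∧ S.comp (a, v.2) = R.comp v := by
  obtain ⟨w, hwv, e1, e2⟩ := h.isEdge_partner_snd
  have s1 := sgn_ne_of_isEdge e1
  have s2 := sgn_ne_of_isEdge e2
  have c1 := comp_eq_of_isEdge e1
  have c2 := comp_eq_of_isEdge e2
  rw [(h.agree w e1.1 hwv).1] at s2
  rw [(h.agree w e1.1 hwv).2] at c2
  refine ⟨?_, c2.symm.trans c1⟩
  revert s1 s2
  cases R.sgn w <;> cases R.sgn v <;> cases S.sgn (a, v.2) <;> simp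

theorem agree_vertical (h : IsStabAt R S v a b) :
    S.sgn (v.1, b) = R.sgn v ∧ S.comp (v.1, b) = R.comp v := by
  have := h.transpose.agree_horizontal
  exact this

theorem agree_corner (h : IsStabAt R S v a b) :
    S.sgn (a, b) = !R.sgn v ∧ S.comp (a, b) = R.comp v := by
  have s1 := sgn_ne_of_isEdge h.isEdge_corner
  have c1 := comp_eq_of_isEdge h.isEdge_corner
  rw [h.agree_horizontal.1] at s1
  rw [h.agree_horizontal.2] at c1
  refine ⟨?_, c1.symm⟩
  revert s1
  cases R.sgn v <;> cases S.sgn (a, b) <;> simp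

theorem same {S' : RectDiagram} (h : IsStabAt R S v a b) (h' : IsStabAt R S' v a b) :
    S.Same S' := by
  refine ⟨Finset.ext fun u => by rw [h.mem_iff, h'.mem_iff], fun u hu => ?_⟩
  rcases (h.mem_iff u).1 hu with ⟨h1, h2⟩ | rfl | rfl | rfl
  · rw [(h.agree u h1 h2).1, (h.agree u h1 h2).2, (h'.agree u h1 h2).1, (h'.agree u h1 h2).2]
    exact ⟨rfl, rfl⟩
  · rw [h.agree_horizontal.1, h.agree_horizontal.2, h'.agree_horizontal.1,
      h'.agree_horizontal.2]
    exact ⟨rfl, rfl⟩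
  · rw [h.agree_vertical.1, h.agree_vertical.2, h'.agree_vertical.1, h'.agree_vertical.2]
    exact ⟨rfl, rfl⟩
  · rw [h.agree_corner.1, h.agree_corner.2, h'.agree_corner.1, h'.agree_corner.2]
    exact ⟨rfl, rfl⟩

theorem nonempty (h : IsStabAt R S v a b) : S.verts.Nonempty :=
  ⟨(a, b), (h.mem_iff _).2 (by simp)⟩

theorem exchangeEquiv {S' : RectDiagram} (h : IsStabAt R S v a b) (h' : IsStabAt R S' v a b) :
    ExchangeEquiv S S' :=
  (h.same h').exchangeEquiv h.nonempty

/-- The meridian of the new corner of a stabilization can be moved towards the stabilized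
vertex. -/
theorem shrink_fst (h : IsStabAt R S v a b) {d d' : Bool} {a' : Real.Angle}
    (hE : ∀ u ∈ R.verts, u.1 ∈ dirArc d v.1 a → u.2 ∈ dirArc d' v.2 b → u = v)
    (ha' : a' ∈ dirArc d v.1 a) (hav : a' ≠ v.1) (hR : ∀ u ∈ R.verts, u.1 ≠ a') :
    ∃ S', ExchangeEquiv S S' ∧ IsStabAt R S' v a' b := by
  by_cases haa : a = a'
  · subst haa
    exact ⟨S, .refl, h⟩
  have hva := h.fst_ne v h.mem
  have hvb := h.snd_ne v h.mem
  refine ⟨S.swapFst a a', .single ?_, h.mem, hR, h.snd_ne, ?_, ?_⟩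
  · refine isExchange_swapFst (p := v.2) (q := b) (!d) d' ?_ ?_ hvb ?_ ?_
    · exact (h.mem_iff _).2 (by simp)
    · exact (h.mem_iff _).2 (by simp)
    · intro u hu
      rcases (h.mem_iff u).1 hu with ⟨h1, h2⟩ | rfl | rfl | rfl
      · exact hR u h1
      · exact haa
      · exact hav.symm
      · exact haa
    · intro u hu h1 h2
      rw [dirArc_not] at h1
      rcases (h.mem_iff u).1 hu with ⟨h3, h4⟩ | rfl | rfl | rfl
      · exact absurd (hE u h3 (dirArc_subset' ha' h1) h2) h4
      · rfl
      · exact absurd h1 (notMem_dirArc ha' hav)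
      · rfl
  · rintro ⟨x, y⟩
    rw [RectDiagram.mem_swapFst, h.mem_iff]
    have hx := hR (x, y)
    have hx' := h.fst_ne (x, y)
    by_cases h1 : x = a
    · subst h1
      have := hR (a', y)
      simp only [Equiv.swap_apply_left, Prod.mk.injEq, ne_eq] at *
      grind
    · by_cases h2 : x = a'
      · subst h2
        have := h.fst_ne (a, y)
        have h3 := Ne.symm hva
        simp only [Equiv.swap_apply_right, Prod.mk.injEq, ne_eq] at *
        grind
      · simp only [Equiv.swap_apply_of_ne_of_ne h1 h2, Prod.mk.injEq, h1, h2]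
  · intro u hu huv
    rw [RectDiagram.sgn_swapFst, RectDiagram.comp_swapFst,
      Equiv.swap_apply_of_ne_of_ne (h.fst_ne u hu) (hR u hu)]
    exact h.agree u hu huv

theorem shrink_snd (h : IsStabAt R S v a b) {d d' : Bool} {b' : Real.Angle}
    (hE : ∀ u ∈ R.verts, u.1 ∈ dirArc d v.1 a → u.2 ∈ dirArc d' v.2 b → u = v)
    (hb' : b' ∈ dirArc d' v.2 b) (hbv : b' ≠ v.2) (hR : ∀ u ∈ R.verts, u.2 ≠ b') :
    ∃ S', ExchangeEquiv S S' ∧ IsStabAt R S' v a b' := by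
  have hE' : ∀ u ∈ R.transpose.verts, u.1 ∈ dirArc d' v.swap.1 b →
      u.2 ∈ dirArc d v.swap.2 a → u = v.swap := by
    intro u hu h1 h2
    rw [← hE u.swap (RectDiagram.mem_transpose.1 hu) h2 h1, Prod.swap_swap]
  obtain ⟨S', h1, h2⟩ := h.transpose.shrink_fst hE' hb' hbv
    (fun u hu => hR u.swap (RectDiagram.mem_transpose.1 hu))
  exact ⟨S'.transpose, exchangeEquiv_of_transpose h.nonempty h1, h2.of_transpose⟩

/-- A stabilization near one endpoint of a vertical edge can be moved to the other endpoint. -/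
theorem slide (h : IsStabAt R S v a b) {d : Bool} {w : Torus} {a' : Real.Angle}
    (hw : w ∈ R.verts) (hwv : w ≠ v) (hwv1 : w.1 = v.1)
    (ha : ∀ u ∈ R.verts, u.1 ∈ dirArc d v.1 a → u.1 = v.1)
    (hav' : a' ≠ v.1) (haa' : a ∉ dirArc (!d) v.1 a')
    (ha' : ∀ u ∈ R.verts, u.1 ∈ dirArc (!d) v.1 a' → u.1 = v.1) :
    ∃ S', ExchangeEquiv S S' ∧ IsStabAt R S' w a' b := by
  have hva := h.fst_ne v h.mem
  have hvb := h.snd_ne v h.mem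
  have hR' : ∀ u ∈ R.verts, u.1 ≠ a' := fun u hu hua =>
    hav' (hua ▸ ha' u hu (hua ▸ right_mem_dirArc _ _ _))
  have hne : a ≠ a' := fun hh => haa' (hh ▸ right_mem_dirArc _ _ _)
  have ha'a : a' ∉ dirArc d v.1 a := fun hh =>
    haa' (by rw [dirArc_not]; exact mem_dirArc_of_notMem (notMem_dirArc hh hav'))
  have e1 : IsExchange S (S.swapFst v.1 a') := by
    refine isExchange_swapFst (p := b) (q := w.2) (!d) true ?_ ?_ (h.snd_ne w hw).symm ?_ ?_
    · exact (h.mem_iff _).2 (by simp)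
    · exact (h.mem_iff _).2 (.inl (by rw [← hwv1]; exact ⟨hw, hwv⟩))
    · intro u hu
      rcases (h.mem_iff u).1 hu with ⟨h1, h2⟩ | rfl | rfl | rfl
      · exact hR' u h1
      · exact hne
      · exact hav'.symm
      · exact hne
    · intro u hu h1 _
      rcases (h.mem_iff u).1 hu with ⟨h3, h4⟩ | rfl | rfl | rfl
      · exact ha' u h3 h1
      · exact absurd h1 haa'
      · rfl
      · exact absurd h1 haa'
  have hm1 : ∀ x y, (x, y) ∈ (S.swapFst v.1 a').verts ↔
      ((x, y) ∈ R.verts ∧ x ≠ v.1) ∨ (x = a ∧ (y = v.2 ∨ y = b)) ∨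
        (x = a' ∧ (y = w.2 ∨ y = b)) := by
    intro x y
    rw [RectDiagram.mem_swapFst, h.mem_iff]
    by_cases h1 : x = v.1
    · subst h1
      have := hR' (a', y)
      simp only [Equiv.swap_apply_left, Prod.mk.injEq, ne_eq] at *
      grind
    · by_cases h2 : x = a'
      · subst h2
        have h3 := hR' (x, y)
        have h4 : ((v.1, y) ∈ R.verts ∧ (v.1, y) ≠ v) ↔ y = w.2 := by
          constructor
          · rintro ⟨h5, h6⟩
            rcases eq_or_eq_of_fst_eq hw h.mem h5 hwv hwv1 hwv1.symm with h7 | h7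
            · rw [← h7]
            · exact absurd h7 h6
          · rintro rfl
            rw [← hwv1]
            exact ⟨hw, hwv⟩
        simp only [Equiv.swap_apply_right, h4, Prod.mk.injEq, ne_eq] at *
        grind
      · have : (x, y) ≠ v := fun hh => h1 (by rw [← hh])
        simp only [Equiv.swap_apply_of_ne_of_ne h1 h2, Prod.mk.injEq, h1, h2]
        grind
  have hfree : ∀ u ∈ (S.swapFst v.1 a').verts, u.1 ≠ v.1 := by
    rintro ⟨x, y⟩ hu
    rcases (hm1 x y).1 hu with ⟨-, h1⟩ | ⟨rfl, -⟩ | ⟨rfl, -⟩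
    · exact h1
    · exact hva.symm
    · exact hav'
  have e2 : IsExchange (S.swapFst v.1 a') ((S.swapFst v.1 a').swapFst a v.1) := by
    refine isExchange_swapFst (p := v.2) (q := b) (!d) true ?_ ?_ hvb hfree ?_
    · exact (hm1 _ _).2 (by simp)
    · exact (hm1 _ _).2 (by simp)
    · rintro ⟨x, y⟩ hu h1 _
      rw [dirArc_not] at h1
      rcases (hm1 x y).1 hu with ⟨h2, h3⟩ | ⟨rfl, -⟩ | ⟨rfl, -⟩
      · exact absurd (ha _ h2 h1) h3
      · rfl
      · exact absurd h1 ha'a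
  refine ⟨_, (Relation.ReflTransGen.single e1).tail e2, hw, hR', h.snd_ne, ?_, ?_⟩
  · rintro ⟨x, y⟩
    rw [RectDiagram.mem_swapFst, hm1]
    by_cases h1 : x = a
    · subst h1
      have := h.fst_ne (x, y)
      simp only [Equiv.swap_apply_left, Prod.mk.injEq, ne_eq] at *
      grind
    · by_cases h2 : x = v.1
      · subst h2
        have h3 := h.fst_ne (a, y)
        have h4 : ((v.1, y) ∈ R.verts ∧ (v.1, y) ≠ w) ↔ y = v.2 := by
          constructor
          · rintro ⟨h5, h6⟩
            rcases eq_or_eq_of_fst_eq hw h.mem h5 hwv hwv1 hwv1.symm with h7 | h7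
            · exact absurd h7 h6
            · rw [← h7]
          · rintro rfl
            exact ⟨h.mem, hwv.symm⟩
        simp only [Equiv.swap_apply_right, h4, Prod.mk.injEq, ne_eq] at *
        grind
      · have : (x, y) ≠ w := fun hh => h2 (by rw [← hwv1, ← hh])
        simp only [Equiv.swap_apply_of_ne_of_ne h1 h2, Prod.mk.injEq]
        grind
  · intro u hu huw
    rw [RectDiagram.sgn_swapFst, RectDiagram.comp_swapFst, RectDiagram.sgn_swapFst,
      RectDiagram.comp_swapFst]
    by_cases huv : u.1 = v.1
    · rcases eq_or_eq_of_fst_eq hw h.mem hu hwv hwv1 (huv.trans hwv1.symm) with rfl | rfl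
      · exact absurd rfl huw
      · simp only [Equiv.swap_apply_right, Equiv.swap_apply_of_ne_of_ne hva.symm hne]
        exact h.agree_horizontal
    · rw [Equiv.swap_apply_of_ne_of_ne (h.fst_ne u hu) huv]
      simp only [Equiv.swap_apply_of_ne_of_ne huv (hR' u hu)]
      exact h.agree u hu fun hh => huv (by rw [hh])

end IsStabAt

end Stabilization

section Directed

variable {R S : RectDiagram} {v w : Torus} {d d' : Bool}

theorem RectDiagram.exists_near_fst (R : RectDiagram) (d : Bool) (x : Real.Angle)
    (F : Finset Real.Angle) :
    ∃ a, a ≠ x ∧ (∀ u ∈ R.verts, u.1 ∈ dirArc d x a → u.1 = x) ∧ (∀ u ∈ R.verts, u.1 ≠ a) ∧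
      ∀ z ∈ F, z ≠ x → z ∉ dirArc d x a ∧ a ∈ dirArc d x z := by
  obtain ⟨a, hax, ha⟩ := exists_near d x (F ∪ R.verts.image Prod.fst)
  have h1 : ∀ u ∈ R.verts, u.1 ∈ dirArc d x a → u.1 = x := fun u hu =>
    ha _ (Finset.mem_union_right _ (Finset.mem_image_of_mem _ hu))
  refine ⟨a, hax, h1, fun u hu hua => ?_, fun z hz hzx => ?_⟩
  · exact hax (hua.symm.trans (h1 u hu (hua ▸ right_mem_dirArc _ _ _)))
  · have : z ∉ dirArc d x a := fun hh => hzx (ha z (Finset.mem_union_left _ hz) hh)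
    exact ⟨this, mem_dirArc_of_notMem this⟩

theorem RectDiagram.exists_near_snd (R : RectDiagram) (d : Bool) (x : Real.Angle)
    (F : Finset Real.Angle) :
    ∃ a, a ≠ x ∧ (∀ u ∈ R.verts, u.2 ∈ dirArc d x a → u.2 = x) ∧ (∀ u ∈ R.verts, u.2 ≠ a) ∧
      ∀ z ∈ F, z ≠ x → z ∉ dirArc d x a ∧ a ∈ dirArc d x z := by
  obtain ⟨a, h1, h2, h3, h4⟩ := R.transpose.exists_near_fst d x F
  have h : ∀ u ∈ R.verts, u.swap ∈ R.transpose.verts := fun u hu =>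
    RectDiagram.mem_transpose.2 (by simpa using hu)
  exact ⟨a, h1, fun u hu => h2 _ (h u hu), fun u hu => h3 _ (h u hu), h4⟩

/-- `S` is a stabilization of `R` at `v` associated with a rectangle whose sides emanate from
`v` in the directions `d` and `d'`. -/
def IsDirStab (R S : RectDiagram) (v : Torus) (d d' : Bool) : Prop :=
  ∃ a b, IsStabAt R S v a b ∧
    ∀ u ∈ R.verts, u.1 ∈ dirArc d v.1 a → u.2 ∈ dirArc d' v.2 b → u = v

theorem IsDirStab.transpose (h : IsDirStab R S v d d') :
    IsDirStab R.transpose S.transpose v.swap d' d := by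
  obtain ⟨a, b, h, hE⟩ := h
  refine ⟨b, a, h.transpose, fun u hu h1 h2 => ?_⟩
  rw [← hE u.swap (RectDiagram.mem_transpose.1 hu) h2 h1, Prod.swap_swap]

theorem IsDirStab.of_transpose (h : IsDirStab R.transpose S v.swap d' d) :
    IsDirStab R S.transpose v d d' := by
  obtain ⟨a, b, h, hE⟩ := h
  refine ⟨b, a, h.of_transpose, fun u hu h1 h2 => ?_⟩
  exact Prod.swap_injective
    (hE u.swap (RectDiagram.mem_transpose.2 (by simpa using hu)) h2 h1)

theorem IsStabAt.shrink {a b a' b' : Real.Angle} (h : IsStabAt R S v a b)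
    (hE : ∀ u ∈ R.verts, u.1 ∈ dirArc d v.1 a → u.2 ∈ dirArc d' v.2 b → u = v)
    (ha' : a' ∈ dirArc d v.1 a) (hav : a' ≠ v.1) (hRa : ∀ u ∈ R.verts, u.1 ≠ a')
    (hb' : b' ∈ dirArc d' v.2 b) (hbv : b' ≠ v.2) (hRb : ∀ u ∈ R.verts, u.2 ≠ b') :
    ∃ S', ExchangeEquiv S S' ∧ IsStabAt R S' v a' b' := by
  obtain ⟨S', h1, h2⟩ := h.shrink_fst hE ha' hav hRa
  obtain ⟨S'', h3, h4⟩ := h2.shrink_snd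
    (fun u hu hu1 hu2 => hE u hu (dirArc_subset ha' hu1) hu2) hb' hbv hRb
  exact ⟨S'', h1.trans h3, h4⟩

theorem IsDirStab.exchangeEquiv {S' : RectDiagram} (h : IsDirStab R S v d d')
    (h' : IsDirStab R S' v d d') : ExchangeEquiv S S' := by
  obtain ⟨a, b, h, hE⟩ := h
  obtain ⟨a', b', h', hE'⟩ := h'
  obtain ⟨x, hx1, -, hx3, hx4⟩ := R.exists_near_fst d v.1 {a, a'}
  obtain ⟨y, hy1, -, hy3, hy4⟩ := R.exists_near_snd d' v.2 {b, b'}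
  obtain ⟨T, hT, hT'⟩ := h.shrink hE (hx4 a (by simp) (h.fst_ne v h.mem).symm).2 hx1 hx3
    (hy4 b (by simp) (h.snd_ne v h.mem).symm).2 hy1 hy3
  obtain ⟨U, hU, hU'⟩ := h'.shrink hE' (hx4 a' (by simp) (h'.fst_ne v h.mem).symm).2 hx1 hx3
    (hy4 b' (by simp) (h'.snd_ne v h.mem).symm).2 hy1 hy3
  exact hT.trans ((hT'.exchangeEquiv hU').trans hU.symm)

theorem IsDirStab.slide_fst (h : IsDirStab R S v d d') (hw : w ∈ R.verts) (hwv : w ≠ v)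
    (hwv1 : w.1 = v.1) : ∃ S', ExchangeEquiv S S' ∧ IsDirStab R S' w (!d) (!d') := by
  obtain ⟨a, b, h, hE⟩ := h
  have hwv2 : w.2 ≠ v.2 := fun h2 => hwv (Prod.ext hwv1 h2)
  obtain ⟨x, hx1, hx2, hx3, hx4⟩ := R.exists_near_fst d v.1 {a}
  obtain ⟨y, hy1, -, hy3, hy4⟩ := R.exists_near_snd d' v.2 {b, w.2}
  obtain ⟨T, hT, hT'⟩ := h.shrink hE (hx4 a (by simp) (h.fst_ne v h.mem).symm).2 hx1 hx3
    (hy4 b (by simp) (h.snd_ne v h.mem).symm).2 hy1 hy3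
  obtain ⟨z, hz1, hz2, hz3, hz4⟩ := R.exists_near_fst (!d) v.1 {x}
  obtain ⟨U, hU, hU'⟩ := hT'.slide hw hwv hwv1 hx2 hz1 (hz4 x (by simp) hx1).1 hz2
  refine ⟨U, hT.trans hU, z, y, hU', fun u hu h1 h2 => ?_⟩
  rw [hwv1] at h1
  rcases eq_or_eq_of_fst_eq hw h.mem hu hwv hwv1 ((hz2 u hu h1).trans hwv1.symm) with rfl | rfl
  · rfl
  · rw [dirArc_not] at h2
    exact absurd h2 (notMem_dirArc (hy4 w.2 (by simp) hwv2).2 hy1)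

theorem IsDirStab.nonempty (h : IsDirStab R S v d d') : S.verts.Nonempty := by
  obtain ⟨a, b, h, -⟩ := h
  exact h.nonempty

theorem IsDirStab.slide (h : IsDirStab R S v d d') (he : IsEdge R v w) :
    ∃ S', ExchangeEquiv S S' ∧ IsDirStab R S' w (!d) (!d') := by
  obtain ⟨-, hw, hvw, h1 | h1⟩ := he
  · exact h.slide_fst hw hvw.symm h1.symm
  · obtain ⟨S', h2, h3⟩ := h.transpose.slide_fst (w := w.swap)
      (RectDiagram.mem_transpose.2 (by simpa using hw)) (by simpa using hvw.symm) h1.symm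
    exact ⟨S'.transpose, exchangeEquiv_of_transpose h.nonempty h2, h3.of_transpose⟩

theorem IsDirStab.slide_path {c c' : Bool}
    (h : IsDirStab R S v (xor (R.sgn v) c) (xor (R.sgn v) c'))
    (hp : Relation.ReflTransGen (IsEdge R) v w) :
    ∃ S', ExchangeEquiv S S' ∧ IsDirStab R S' w (xor (R.sgn w) c) (xor (R.sgn w) c') := by
  induction hp with
  | refl => exact ⟨S, .refl, h⟩
  | @tail x y _ he ih =>
    obtain ⟨T, h1, h2⟩ := ih
    obtain ⟨U, h3, h4⟩ := h2.slide he
    have hs : R.sgn y = !R.sgn x := by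
      have := sgn_ne_of_isEdge he
      revert this
      cases R.sgn x <;> cases R.sgn y <;> simp
    refine ⟨U, h1.trans h3, ?_⟩
    rwa [hs, Bool.not_xor, Bool.not_xor]

end Directed

section Types

variable {R S : RectDiagram} {t1 t2 p1 p2 : Real.Angle}

theorem IsStabWith.exists_mem (h : IsStabWith R S t1 t2 p1 p2) :
    ∃ v ∈ R.verts, v ∈ corners t1 t2 p1 p2 ∧ ∀ u ∈ R.verts, u ∈ corners t1 t2 p1 p2 → u = v := by
  obtain ⟨⟨h1, h2, h3, -⟩, h9⟩ := h
  have hc : (corners t1 t2 p1 p2).card = 4 := by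
    simp [corners, h1, h2]
  have e1 : (symmDiff R.verts S.verts).card = (R.verts \ S.verts).card +
      (S.verts \ R.verts).card := Finset.card_union_of_disjoint disjoint_sdiff_sdiff
  have e2 := Finset.card_sdiff_add_card_inter R.verts S.verts
  have e3 := Finset.card_sdiff_add_card_inter S.verts R.verts
  rw [Finset.inter_comm] at e3
  rw [h3, hc] at e1
  have e4 : (R.verts \ S.verts).card = 1 := by omega
  obtain ⟨v, hv⟩ := Finset.card_eq_one.1 e4
  have hmem : ∀ u, (u ∈ R.verts ∧ u ∈ corners t1 t2 p1 p2) ↔ u = v := by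
    intro u
    rw [← Finset.mem_singleton, ← hv, ← h3, Finset.mem_symmDiff, Finset.mem_sdiff]
    tauto
  exact ⟨v, ((hmem v).2 rfl).1, ((hmem v).2 rfl).2, fun u hu hu' => (hmem u).1 ⟨hu, hu'⟩⟩

theorem IsStabWith.isStabAt (h : IsStabWith R S t1 t2 p1 p2) {v : Torus} {a b : Real.Angle}
    (hv : v ∈ R.verts) (ha : v.1 = t1 ∧ a = t2 ∨ v.1 = t2 ∧ a = t1)
    (hb : v.2 = p1 ∧ b = p2 ∨ v.2 = p2 ∧ b = p1) : IsStabAt R S v a b := by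
  obtain ⟨v', hv1, hv2, hv3⟩ := h.exists_mem
  obtain ⟨⟨h1, h2, h3, -, -, -, -, h8⟩, -⟩ := h
  have hc : ∀ u : Torus, u ∈ corners t1 t2 p1 p2 ↔ u = v ∨ u = (a, v.2) ∨ u = (v.1, b) ∨
      u = (a, b) := by
    rintro ⟨x, y⟩
    obtain ⟨z, w⟩ := v
    rw [mem_corners]
    simp only [Prod.mk.injEq] at *
    grind
  have hvc : v ∈ corners t1 t2 p1 p2 := (hc v).2 (by simp)
  obtain rfl : v = v' := hv3 v hv hvc
  have hva : v.1 ≠ a := by grind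
  have hvb : v.2 ≠ b := by grind
  have hsd : ∀ u, (u ∈ R.verts ∧ u ∉ S.verts ∨ u ∈ S.verts ∧ u ∉ R.verts) ↔
      u ∈ corners t1 t2 p1 p2 := fun u => by rw [← h3, Finset.mem_symmDiff]
  have hcS : ∀ u ∈ corners t1 t2 p1 p2, u ≠ v → u ∈ S.verts := by
    intro u hu huv
    rcases (hsd u).2 hu with h | h
    · exact absurd (hv3 u h.1 hu) huv
    · exact h.1
  have hRS : ∀ u ∈ R.verts, u ≠ v → u ∈ S.verts := by
    intro u hu huv
    by_contra hc
    exact huv (hv3 u hu ((hsd u).1 (.inl ⟨hu, hc⟩)))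
  have hvS : v ∉ S.verts := by
    rcases (hsd v).2 hvc with h | h
    · exact h.2
    · exact absurd hv h.2
  have m1 : (a, v.2) ∈ corners t1 t2 p1 p2 := (hc _).2 (by simp)
  have m2 : (v.1, b) ∈ corners t1 t2 p1 p2 := (hc _).2 (by simp)
  have m3 : (a, b) ∈ corners t1 t2 p1 p2 := (hc _).2 (by simp)
  have n1 : (a, v.2) ∈ S.verts := hcS _ m1 fun hh => hva (by rw [← hh])
  have n2 : (v.1, b) ∈ S.verts := hcS _ m2 fun hh => hvb (by rw [← hh])
  have n3 : (a, b) ∈ S.verts := hcS _ m3 fun hh => hva (by rw [← hh])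
  refine ⟨hv, fun u hu hua => ?_, fun u hu hub => ?_, fun u => ⟨fun hu => ?_, ?_⟩,
    fun u hu huv => ?_⟩
  · have huv : u ≠ v := fun hh => hva (by rw [← hh, hua])
    rcases eq_or_eq_of_fst_eq n1 n3 (hRS u hu huv) (by simpa using hvb) rfl hua with rfl | rfl
    · exact huv (hv3 _ hu m1)
    · exact huv (hv3 _ hu m3)
  · have huv : u ≠ v := fun hh => hvb (by rw [← hh, hub])
    rcases eq_or_eq_of_snd_eq n2 n3 (hRS u hu huv) (by simpa using hva) rfl hub with rfl | rfl
    · exact huv (hv3 _ hu m2)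
    · exact huv (hv3 _ hu m3)
  · have huv : u ≠ v := fun hh => hvS (hh ▸ hu)
    by_cases huR : u ∈ R.verts
    · exact .inl ⟨huR, huv⟩
    · exact .inr (((hc u).1 ((hsd u).1 (.inr ⟨hu, huR⟩))).resolve_left huv)
  · rintro (⟨hu, huv⟩ | rfl | rfl | rfl)
    exacts [hRS u hu huv, n1, n2, n3]
  · have := h8 u (Finset.mem_inter.2 ⟨hu, hRS u hu huv⟩)
    exact ⟨this.1.symm, this.2.symm⟩

theorem IsStabWith.isDirStab (h : IsStabWith R S t1 t2 p1 p2) {v : Torus} {a b : Real.Angle}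
    (hv : v ∈ R.verts) {d d' : Bool}
    (ha : v.1 = t1 ∧ a = t2 ∧ d = true ∨ v.1 = t2 ∧ a = t1 ∧ d = false)
    (hb : v.2 = p1 ∧ b = p2 ∧ d' = true ∨ v.2 = p2 ∧ b = p1 ∧ d' = false) :
    IsStabAt R S v a b ∧ IsDirStab R S v d d' := by
  have hs := h.isStabAt hv (ha.imp (fun h => ⟨h.1, h.2.1⟩) fun h => ⟨h.1, h.2.1⟩)
    (hb.imp (fun h => ⟨h.1, h.2.1⟩) fun h => ⟨h.1, h.2.1⟩)
  refine ⟨hs, a, b, hs, fun u hu h1 h2 => ?_⟩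
  obtain ⟨v', hv1, hv2, hv3⟩ := h.exists_mem
  have hvc : v ∈ corners t1 t2 p1 p2 := by
    rw [mem_corners]
    exact ⟨ha.imp And.left And.left, hb.imp And.left And.left⟩
  have h7 := h.1.2.2.2.2.2.2.1
  have hA : dirArc d v.1 a = Arc t1 t2 := by
    rcases ha with ⟨e1, e2, e3⟩ | ⟨e1, e2, e3⟩ <;> rw [e1, e2, e3] <;> rfl
  have hB : dirArc d' v.2 b = Arc p1 p2 := by
    rcases hb with ⟨e1, e2, e3⟩ | ⟨e1, e2, e3⟩ <;> rw [e1, e2, e3] <;> rfl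
  have huc : u ∈ corners t1 t2 p1 p2 := by
    rw [← Finset.mem_coe, ← h7]
    exact ⟨⟨hA ▸ h1, hB ▸ h2⟩, .inl hu⟩
  exact (hv3 u hu huc).trans (hv3 v hv hvc).symm

/-- The sign of the vertices at which a stabilization of the given oriented type uses the
negative direction along the first coordinate. -/
def OType.fstDir : OType → Bool
  | .posI => true
  | .negI => false
  | .posII => true
  | .negII => false

/-- The sign of the vertices at which a stabilization of the given oriented type uses the
negative direction along the second coordinate. -/
def OType.sndDir : OType → Bool
  | .posI => true
  | .negI => false
  | .posII => false
  | .negII => true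

theorem IsStabWith.isDirStab_typeI (h : IsStabWith R S t1 t2 p1 p2)
    (hI : TypeICornerCond R t1 t2 p1 p2) {p0 : Real.Angle} (hp0 : p0 = p1 ∨ p0 = p2)
    (h1 : (t1, p0) ∈ S.verts) (h2 : (t2, p0) ∈ S.verts) :
    ∃ v a b, IsStabAt R S v a b ∧
      IsDirStab R S v (xor (R.sgn v) (S.sgn (t2, p0))) (xor (R.sgn v) (S.sgn (t2, p0))) := by
  obtain ⟨v, hv, hvc, -⟩ := h.exists_mem
  have hvS : v ∉ S.verts := by
    rw [← h.1.2.2.1, Finset.mem_symmDiff] at hvc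
    rcases hvc with hh | hh
    · exact hh.2
    · exact absurd hv hh.2
  rcases hI v hv hvc with rfl | rfl
  · obtain ⟨e1, e2⟩ := h.isDirStab (d := true) (d' := true) hv (.inl ⟨rfl, rfl, rfl⟩)
      (.inl ⟨rfl, rfl, rfl⟩)
    rcases hp0 with rfl | rfl
    · exact absurd h1 hvS
    · refine ⟨_, _, _, e1, ?_⟩
      rw [e1.agree_corner.1]
      simpa using e2
  · obtain ⟨e1, e2⟩ := h.isDirStab (d := false) (d' := false) hv (.inr ⟨rfl, rfl, rfl⟩)
      (.inr ⟨rfl, rfl, rfl⟩)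
    rcases hp0 with rfl | rfl
    · refine ⟨_, _, _, e1, ?_⟩
      have := e1.agree_vertical.1
      dsimp only at this
      rw [this]
      simpa using e2
    · exact absurd h2 hvS

theorem IsStabWith.isDirStab_typeII (h : IsStabWith R S t1 t2 p1 p2)
    (hI : TypeIICornerCond R t1 t2 p1 p2) {p0 : Real.Angle} (hp0 : p0 = p1 ∨ p0 = p2)
    (h1 : (t1, p0) ∈ S.verts) (h2 : (t2, p0) ∈ S.verts) :
    ∃ v a b, IsStabAt R S v a b ∧
      IsDirStab R S v (xor (R.sgn v) (S.sgn (t2, p0))) (xor (R.sgn v) (!S.sgn (t2, p0))) := by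
  obtain ⟨v, hv, hvc, -⟩ := h.exists_mem
  have hvS : v ∉ S.verts := by
    rw [← h.1.2.2.1, Finset.mem_symmDiff] at hvc
    rcases hvc with hh | hh
    · exact hh.2
    · exact absurd hv hh.2
  rcases hI v hv hvc with rfl | rfl
  · obtain ⟨e1, e2⟩ := h.isDirStab (d := true) (d' := false) hv (.inl ⟨rfl, rfl, rfl⟩)
      (.inr ⟨rfl, rfl, rfl⟩)
    rcases hp0 with rfl | rfl
    · refine ⟨_, _, _, e1, ?_⟩
      rw [e1.agree_corner.1]
      simpa using e2
    · exact absurd h1 hvS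
  · obtain ⟨e1, e2⟩ := h.isDirStab (d := false) (d' := true) hv (.inr ⟨rfl, rfl, rfl⟩)
      (.inl ⟨rfl, rfl, rfl⟩)
    rcases hp0 with rfl | rfl
    · exact absurd h2 hvS
    · refine ⟨_, _, _, e1, ?_⟩
      have := e1.agree_vertical.1
      dsimp only at this
      rw [this]
      simpa using e2

theorem IsStabOfOType.exists_isDirStab {t : OType} {i : ℕ} (h : IsStabOfOType R S t)
    (hc : ModifiesComp R S i) : ∃ v ∈ R.verts, R.comp v = i ∧
      IsDirStab R S v (xor (R.sgn v) t.fstDir) (xor (R.sgn v) t.sndDir) := by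
  obtain ⟨t1, t2, p1, p2, h, p0, hp0, h1, h2, ht⟩ := h
  have key : ∃ v a b, IsStabAt R S v a b ∧
      IsDirStab R S v (xor (R.sgn v) t.fstDir) (xor (R.sgn v) t.sndDir) := by
    cases t <;> obtain ⟨hI, hs⟩ := ht
    · have := h.isDirStab_typeI hI hp0 h1 h2
      simp only [hs] at this
      exact this
    · have := h.isDirStab_typeI hI hp0 h1 h2
      simp only [hs] at this
      exact this
    · have := h.isDirStab_typeII hI hp0 h1 h2
      simp only [hs] at this
      exact this
    · have := h.isDirStab_typeII hI hp0 h1 h2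
      simp only [hs] at this
      exact this
  obtain ⟨v, a, b, e1, e2⟩ := key
  obtain ⟨u, hu, huS, hui⟩ := hc
  have huv : u = v := by
    by_contra hne
    exact huS ((e1.mem_iff u).2 (.inl ⟨hu, hne⟩))
  exact ⟨v, e1.mem, huv ▸ hui, e2⟩

end Types

/-- Two stabilizations of a diagram `R` of the same oriented type performed on the
connected component with the same number yield diagrams related by a chain of exchange
moves. -/
theorem stabs_same_otype_related_by_exchanges (R R₁ R₂ : RectDiagram) (t : OType) (i : ℕ)
    (h₁ : IsStabOfOType R R₁ t) (h₁c : ModifiesComp R R₁ i)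
    (h₂ : IsStabOfOType R R₂ t) (h₂c : ModifiesComp R R₂ i) :
    Relation.ReflTransGen IsExchange R₁ R₂ := by
  obtain ⟨v, hv, hvi, e⟩ := h₁.exists_isDirStab h₁c
  obtain ⟨w, hw, hwi, f⟩ := h₂.exists_isDirStab h₂c
  obtain ⟨S, hS, g⟩ := e.slide_path (reflTransGen_isEdge hv hw (hvi.trans hwi.symm))
  exact hS.trans (g.exchangeEquiv f)

end RectDiag
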